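/- Let B be a finite nonempty set and ∅ ≠ M ⊆ ℕ^B an upper set. Suppose T ∈ ℕ is minimal such that μ_T(M) ≥ 1/2, and U < T is a nonnegative integer. Then μ_U(M) ≤ U/(T+U-1) (with the convention 0/0 = 0 when U = 0 and T = 1). -/

import Mathlib

open Finset

/-- The uniform probability of the event `M` under the uniform distribution on
functions `f : B → ℕ` with `∑ b, f b = T`. -/
noncomputable def uniformProb (B : Type*) [Fintype B] (T : ℕ) (M : Set (B → ℕ)) : ℝ := by
  classical
  exact (((Fintype.piFinset fun _ : B => Finset.range (T + 1)).filter
        (fun f => (∑ b, f b) = T ∧ f ∈ M)).card : ℝ) /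
      (((Fintype.piFinset fun _ : B => Finset.range (T + 1)).filter
        (fun f => (∑ b, f b) = T)).card : ℝ)


/-- Concave building block. -/
lemma mob_concave (a d : ℝ) (ha : 0 ≤ a) (hd : 0 < d) :
    ConcaveOn ℝ (Set.Ici (0:ℝ)) (fun x => x * a / (d + x)) := by
  refine ⟨convex_Ici 0, ?_⟩
  intro x hx y hy s t hs ht hst
  simp only [Set.mem_Ici] at hx hy
  simp only [smul_eq_mul]
  have h1 : 0 < d + x := by linarith
  have h2 : 0 < d + y := by linarith
  have h3 : 0 < d + (s * x + t * y) := by positivity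
  have hs' : s = 1 - t := by linarith
  have ht1 : 0 ≤ 1 - t := by linarith
  rw [← sub_nonneg]
  have : (s * x + t * y) * a / (d + (s * x + t * y)) -
      (s * (x * a / (d + x)) + t * (y * a / (d + y))) =
      a * d * (1 - t) * t * (x - y)^2 / ((d + (s * x + t * y)) * (d + x) * (d + y)) := by
    subst hs'
    field_simp
    ring
  rw [this]
  positivity

/-- min at the endpoints for the sum of two blocks -/
lemma mob_sum_min (a d b e p x y u c : ℝ) (ha : 0 ≤ a) (hd : 0 < d) (hb : 0 ≤ b) (he : 0 < e)
    (hx : 0 ≤ x) (hxu : x ≤ u) (huy : u ≤ y) (hyp : y ≤ p)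
    (h1 : c ≤ x * a / (d + x) + (p - x) * b / (e + (p - x)))
    (h2 : c ≤ y * a / (d + y) + (p - y) * b / (e + (p - y))) :
    c ≤ u * a / (d + u) + (p - u) * b / (e + (p - u)) := by
  rcases eq_or_lt_of_le (hxu.trans huy) with hxy | hxy
  · have : u = x := by linarith
    rw [this]; exact h1
  have hl : 0 < y - x := by linarith
  have hw : (y - u) / (y - x) + (u - x) / (y - x) = 1 := by field_simp; ring
  have hw1 : 0 ≤ (y - u) / (y - x) := div_nonneg (by linarith) hl.le
  have hw2 : 0 ≤ (u - x) / (y - x) := div_nonneg (by linarith) hl.le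
  have e1 : (y - u) / (y - x) * x + (u - x) / (y - x) * y = u := by field_simp; ring
  have e2 : (y - u) / (y - x) * (p - x) + (u - x) / (y - x) * (p - y) = p - u := by
    field_simp; ring
  have c1 := (mob_concave a d ha hd).2 (x := x) hx (y := y) (show (0:ℝ) ≤ y by linarith) hw1 hw2 hw
  have c2 := (mob_concave b e hb he).2 (x := p - x) (show (0:ℝ) ≤ p - x by linarith)
    (y := p - y) (show (0:ℝ) ≤ p - y by linarith) hw1 hw2 hw
  simp only [smul_eq_mul] at c1 c2
  rw [e1] at c1
  rw [e2] at c2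
  have m1 := mul_le_mul_of_nonneg_left h1 hw1
  have m2 := mul_le_mul_of_nonneg_left h2 hw2
  have : c = (y - u) / (y - x) * c + (u - x) / (y - x) * c := by rw [← add_mul, hw, one_mul]
  linarith

/-- endpoint L -/
lemma endL (q a p : ℝ) (hq : 0 < q) (ha : 1 ≤ a) (hL : a / (q + a) ≤ p) (hp : p ≤ 1) :
    p * (q + 1 + a) / (a + p) ≤
      1 + (p - a/(q+a)) * q / (a * q / (q + a) + (p - a/(q+a))) := by
  have hqa : 0 < q + a := by linarith
  have hp0 : 0 < p := lt_of_lt_of_le (by positivity) hL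
  rw [div_le_iff₀ hqa] at hL
  have hden : 0 < a * q + p * (q + a) - a := by nlinarith
  have : a * q / (q + a) + (p - a/(q+a)) = (a * q + p * (q + a) - a) / (q + a) := by
    field_simp
    ring
  rw [this, ← sub_nonneg]
  have : 1 + (p - a/(q+a)) * q / ((a * q + p * (q + a) - a) / (q + a)) - p * (q + 1 + a) / (a + p)
     = (1 - p) * (p * (q + a) - a) * a / ((a + p) * (a * q + p * (q + a) - a)) := by
    field_simp
    ring
  rw [this]
  have : 0 ≤ p * (q + a) - a := by linarith
  have : 0 ≤ 1 - p := by linarith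
  positivity

/-- endpoint u* -/
lemma endU (q a p : ℝ) (hq : 0 < q) (ha : 1 < a) (hL : a / (q + a) ≤ p) (hp : p ≤ 1) :
    p * (q + 1 + a) / (a + p) ≤
      p + (p - p * (a - 1) * a / ((a - p) * (q + a))) * q /
        (a * q / (q + a) + (p - p * (a - 1) * a / ((a - p) * (q + a)))) := by
  have hqa : 0 < q + a := by linarith
  have hp0 : 0 < p := lt_of_lt_of_le (by positivity) hL
  have hap : 0 < a - p := by linarith
  rw [div_le_iff₀ hqa] at hL
  have hv : p - p * (a - 1) * a / ((a - p) * (q + a)) =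
    p * ((a - p) * (q + a) - (a - 1) * a) / ((a - p) * (q + a)) := by
    field_simp
  have hnum : 0 < (a - p) * (q + a) - (a - 1) * a := by nlinarith
  have hd : a * q / (q + a) + p * ((a - p) * (q + a) - (a - 1) * a) / ((a - p) * (q + a)) =
    (a * q * (a - p) + p * ((a - p) * (q + a) - (a - 1) * a)) / ((a - p) * (q + a)) := by
    field_simp
  have hdp : 0 < a * q * (a - p) + p * ((a - p) * (q + a) - (a - 1) * a) := by positivity
  rw [hv, hd, ← sub_nonneg]
  have hn0 : 0 ≤ p * (q + a) - a := by linarith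
  have hp1 : 0 ≤ 1 - p := by linarith
  obtain ⟨D, hD⟩ : ∃ D, D = a * q * (a - p) + p * ((a - p) * (q + a) - (a - 1) * a) := ⟨_, rfl⟩
  rw [← hD] at hdp ⊢
  have : p + p * ((a - p) * (q + a) - (a - 1) * a) / ((a - p) * (q + a)) * q /
     (D / ((a - p) * (q + a))) - p * (q + 1 + a) / (a + p)
     = p * (p * ((1 - p) * (p * (q + a) - a))) / ((a + p) * D) := by
    field_simp
    rw [hD]
    ring
  rw [this]
  positivity

/-- scaled core inequality, a > 1 -/
lemma core2 (q a p u X Y : ℝ) (hq : 0 < q) (ha : 1 < a) (hL : a / (q + a) ≤ p) (hp : p ≤ 1)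
    (hup : u ≤ p) (hX : p ≤ X)
    (hXA : u * (q + 1 + a) / (a + u) ≤ X)
    (hXA' : u * a / ((a - 1) * a / (q + a) + u) ≤ X)
    (hY : (p - u) * q / (a * q / (q + a) + (p - u)) ≤ Y) :
    p * (q + 1 + a) / (a + p) ≤ X + Y := by
  have hqa : 0 < q + a := by linarith
  have hp0 : 0 < p := lt_of_lt_of_le (by positivity) hL
  have hap : 0 < a - p := by linarith
  have hb := endL q a p hq ha.le hL hp
  have hc := endU q a p hq ha hL hp
  have he : 0 < a * q / (q + a) := by positivity
  have ha1 : 0 < a - 1 := by linarith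
  have hd : 0 < (a - 1) * a / (q + a) := by positivity
  have hAL : a / (q + a) * a / ((a - 1) * a / (q + a) + a / (q + a)) = 1 := by
    field_simp; ring
  have hAL' : a / (q + a) * (q + 1 + a) / (a + a / (q + a)) = 1 := by
    field_simp; ring
  obtain ⟨w, hw⟩ : ∃ w, w = p * (a - 1) * a / ((a - p) * (q + a)) := ⟨_, rfl⟩
  have hw0 : 0 ≤ w := by rw [hw]; positivity
  have hwL : w ≤ a / (q + a) := by
    rw [hw, div_le_div_iff₀ (by positivity) hqa]
    have : p * (a - 1) ≤ a - p := by nlinarith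
    have := mul_le_mul_of_nonneg_right this (show 0 ≤ a * (q + a) by positivity)
    linarith
  have hAw : w * a / ((a - 1) * a / (q + a) + w) = p := by
    have : (a - 1) * a / (q + a) + w = (a-1) * a * a / ((a - p) * (q + a)) := by
      rw [hw]; field_simp; ring
    rw [this, hw]
    field_simp
  rw [← hw] at hc
  rcases le_total u w with h | h
  · have hm : (p - w) * q / (a * q / (q + a) + (p - w)) ≤
        (p - u) * q / (a * q / (q + a) + (p - u)) := by
      rw [div_le_div_iff₀ (by linarith) (by linarith)]
      have := mul_le_mul_of_nonneg_right h (show 0 ≤ q * (a * q / (q + a)) by positivity)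
      nlinarith
    linarith
  · rcases le_total u (a / (q + a)) with h' | h'
    · have := mob_sum_min a ((a - 1) * a / (q + a)) q (a * q / (q + a)) p w (a / (q + a)) u
        (p * (q + 1 + a) / (a + p)) (by linarith) hd hq.le he hw0 h h' hL
        (by rw [hAw]; exact hc) (by rw [hAL]; exact hb)
      linarith
    · have := mob_sum_min (q + 1 + a) a q (a * q / (q + a)) p (a / (q + a)) p u
        (p * (q + 1 + a) / (a + p)) (by linarith) (by linarith) hq.le he (by positivity) h' hup le_rfl
        (by rw [hAL']; exact hb) (by simp)
      linarith

/-- scaled core inequality, a = 1 -/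
lemma core1 (q p u X Y : ℝ) (hq : 0 < q) (hL : 1 / (q + 1) ≤ p) (hp : p ≤ 1)
    (hu0 : u = 0 ∨ 1 / (q + 1) ≤ u) (hup : u ≤ p) (hX : p ≤ X)
    (hXA : u * (q + 1 + 1) / (1 + u) ≤ X)
    (hY : (p - u) * q / (1 * q / (q + 1) + (p - u)) ≤ Y) :
    p * (q + 1 + 1) / (1 + p) ≤ X + Y := by
  have hqa : 0 < q + 1 := by linarith
  have hp0 : 0 < p := lt_of_lt_of_le (by positivity) hL
  have hb := endL q 1 p hq le_rfl hL hp
  have he : 0 < 1 * q / (q + 1) := by positivity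
  have hAL' : 1 / (q + 1) * (q + 1 + 1) / (1 + 1 / (q + 1)) = 1 := by
    field_simp
  rcases hu0 with h | h
  · subst h
    have : p * (q + 1 + 1) / (1 + p) ≤ p + (p - 0) * q / (1 * q / (q + 1) + (p - 0)) := by
      have h2 : 1 * q / (q + 1) + (p - 0) = (q + p * (q + 1)) / (q + 1) := by field_simp; ring
      rw [h2, ← sub_nonneg]
      have : p + (p - 0) * q / ((q + p * (q + 1)) / (q + 1)) - p * (q + 1 + 1) / (1 + p) =
        p * (p * (p * (q + 1) - 1)) / ((1 + p) * (q + p * (q + 1))) := by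
        field_simp
        ring
      rw [this]
      rw [div_le_iff₀ hqa] at hL
      have : 0 ≤ p * (q + 1) - 1 := by linarith
      positivity
    linarith
  · have := mob_sum_min (q + 1 + 1) 1 q (1 * q / (q + 1)) p (1 / (q + 1)) p u
        (p * (q + 1 + 1) / (1 + p)) (by linarith) (by linarith) hq.le he (by positivity) h hup le_rfl
        (by rw [hAL']; exact hb) (by simp)
    linarith

/-- The size of level `j` in `q + 1` variables. -/
noncomputable def lev (q j : ℕ) : ℝ := ((q + j).choose j : ℝ)

lemma lev_pos (q j : ℕ) : 0 < lev q j := by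
  unfold lev
  exact_mod_cast Nat.choose_pos (by omega)

lemma lev_zero (q : ℕ) : lev q 0 = 1 := by simp [lev]

lemma lev_succ (q j : ℕ) : lev q (j + 1) * (j + 1) = lev q j * (q + j + 1) := by
  unfold lev
  have := Nat.add_one_mul_choose_eq (q + j) j
  have h : ((q + j + 1 : ℕ) : ℝ) * ((q+j).choose j : ℝ) = ((q+j+1).choose (j+1) : ℝ) * ((j+1 : ℕ) : ℝ) := by
    exact_mod_cast this
  push_cast at h
  rw [← add_assoc]
  linarith

lemma lev_var (q j : ℕ) : lev (q + 1) j * (q + 1) = lev q j * (q + 1 + j) := by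
  unfold lev
  have := Nat.choose_mul_succ_eq (q + j) j
  have e : q + j + 1 - j = q + 1 := by omega
  rw [e] at this
  have h : ((q+j).choose j : ℝ) * ((q + j + 1 : ℕ) : ℝ) = ((q+j+1).choose j : ℝ) * ((q+1 : ℕ) : ℝ) := by
    exact_mod_cast this
  push_cast at h
  rw [show q + 1 + j = q + j + 1 by ring]
  linarith

lemma lev_mono (q : ℕ) : Monotone (lev q) := by
  refine monotone_nat_of_le_succ fun j => ?_
  have h := lev_succ q j
  have h0 := lev_pos q j
  have hq : (0:ℝ) ≤ q := by positivity
  have hj : (0:ℝ) < (j:ℝ) + 1 := by positivity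
  have : lev q j * (j + 1) ≤ lev q (j + 1) * (j + 1) := by
    rw [h]; nlinarith
  exact le_of_mul_le_mul_right this hj

lemma lev_large (q j : ℕ) : (j : ℝ) + 1 ≤ lev (q + 1) j := by
  induction j with
  | zero => simp [lev_zero]
  | succ j ih =>
    have h := lev_succ (q + 1) j
    push_cast at h ⊢
    have hj : (0:ℝ) < (j:ℝ) + 1 := by positivity
    have hq : (0:ℝ) ≤ q := by positivity
    refine le_of_mul_le_mul_right (a := (j:ℝ)+1) ?_ hj
    rw [h]
    nlinarith [mul_le_mul_of_nonneg_right ih (show (0:ℝ) ≤ q + 1 + j + 1 by positivity)]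

noncomputable def phi (q j : ℕ) (s : ℝ) : ℝ := s * (q + 1 + j) * lev q j / (j * lev q j + s)

lemma phi_cross (q j : ℕ) (s : ℝ) (hs : 0 < s) :
    (s ≤ lev q j → phi q (j + 1) s ≤ phi q j s) ∧ (lev q j ≤ s → phi q j s ≤ phi q (j + 1) s) := by
  have h := lev_succ q j
  have h0 := lev_pos q j
  have h1 := lev_pos q (j + 1)
  have hj : (0:ℝ) < (j:ℝ) + 1 := by positivity
  have e : lev q (j + 1) = lev q j * (q + j + 1) / (j + 1) := by
    rw [← h]; field_simp
  have key : phi q (j + 1) s - phi q j s =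
      s * (s - lev q j) * lev q j * (q + j + 1) * (q + 1) / ((j * lev q j + s) * (lev q j * (q + j + 1) + s) * (j + 1)) := by
    unfold phi
    rw [e]
    push_cast
    have : (j:ℝ) * lev q j + s ≠ 0 := by positivity
    have : lev q j * (q + j + 1) + s ≠ 0 := by positivity
    field_simp
    ring
  constructor
  · intro hle
    have : phi q (j + 1) s - phi q j s ≤ 0 := by
      rw [key]
      apply div_nonpos_of_nonpos_of_nonneg _ (by positivity)
      have : s * (s - lev q j) ≤ 0 := mul_nonpos_of_nonneg_of_nonpos hs.le (by linarith)
      have h3 : 0 ≤ lev q j * (q + j + 1) * (q + 1) := by positivity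
      nlinarith
    linarith
  · intro hle
    have : 0 ≤ phi q (j + 1) s - phi q j s := by
      rw [key]
      have : 0 ≤ s - lev q j := by linarith
      positivity
    linarith

lemma phi_best (q i j : ℕ) (s : ℝ) (hs : 0 < s) (h1 : lev q i ≤ s) (h2 : s ≤ lev q (i + 1)) :
    phi q j s ≤ phi q (i + 1) s := by
  rcases le_total j (i + 1) with h | h
  · have : ∀ d, d ≤ i + 1 → phi q (i + 1 - d) s ≤ phi q (i + 1) s := by
      intro d
      induction d with
      | zero => simp
      | succ d ih =>
        intro hd
        have a := (phi_cross q (i + 1 - (d + 1)) s hs).2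
          ((lev_mono q (show i + 1 - (d + 1) ≤ i by omega)).trans h1)
        rw [show i + 1 - (d + 1) + 1 = i + 1 - d by omega] at a
        exact a.trans (ih (by omega))
    have := this (i + 1 - j) (by omega)
    rwa [show i + 1 - (i + 1 - j) = j by omega] at this
  · obtain ⟨d, rfl⟩ := Nat.exists_eq_add_of_le h
    induction d with
    | zero => simp
    | succ d ih =>
      exact ((phi_cross q (i + 1 + d) s hs).1 (h2.trans (lev_mono q (by omega)))).trans
        (ih (by omega))

lemma exists_range (q s : ℕ) (hs : 1 ≤ s) : ∃ i, lev (q + 1) i ≤ s ∧ (s:ℝ) ≤ lev (q + 1) (i + 1) := by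
  classical
  have hex : ∃ i, (s:ℝ) ≤ lev (q + 1) (i + 1) := ⟨s, by
    have := lev_large q (s + 1); push_cast at this; linarith⟩
  refine ⟨Nat.find hex, ?_, Nat.find_spec hex⟩
  rcases Nat.eq_zero_or_pos (Nat.find hex) with h | h
  · rw [h, lev_zero]; exact_mod_cast hs
  · have := Nat.find_min hex (m := Nat.find hex - 1) (by omega)
    rw [show Nat.find hex - 1 + 1 = Nat.find hex by omega] at this
    linarith

lemma step_range (q i u v X Y : ℕ) (hs : 1 ≤ u + v) (h1 : lev (q + 1) i ≤ (u + v : ℕ))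
    (h2 : ((u + v : ℕ) : ℝ) ≤ lev (q + 1) (i + 1)) (hX : u + v ≤ X)
    (hXA : ∀ j, 1 ≤ j → phi (q + 1) j u ≤ X) (hY : ∀ j, 1 ≤ j → phi q j v ≤ Y) :
    phi (q + 1) (i + 1) (u + v : ℕ) ≤ X + Y := by
  obtain ⟨N, hN⟩ : ∃ N, N = lev (q + 1) (i + 1) := ⟨_, rfl⟩
  have hN0 : 0 < N := hN ▸ lev_pos _ _
  have eL : lev (q + 1) i = N * (i + 1) / (q + 1 + (i + 1)) := by
    have := lev_succ (q + 1) i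
    push_cast at this
    rw [hN, this]; field_simp; ring
  have eR : lev q (i + 1) = N * (q + 1) / (q + 1 + (i + 1)) := by
    have := lev_var q (i + 1)
    push_cast at this
    rw [hN, this]; field_simp
  have hXA1 := hXA (i + 1) (by omega)
  have hY1 := hY (i + 1) (by omega)
  have hXr : ((u + v : ℕ) : ℝ) ≤ X := by exact_mod_cast hX
  have hsr : (1:ℝ) ≤ (u + v : ℕ) := by exact_mod_cast hs
  have hi : (0:ℝ) ≤ i := by positivity
  have hqr : (0:ℝ) ≤ q := by positivity
  unfold phi at hXA1 hY1 ⊢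
  rw [eL] at h1
  rw [eR] at hY1
  rw [← hN] at h2 hXA1 ⊢
  push_cast at *
  have goal' : ((u:ℝ) + v) / N * ((q + 1 : ℝ) + 1 + (i + 1)) / ((i + 1 : ℝ) + ((u:ℝ) + v) / N) ≤ X / N + Y / N →
      ((u:ℝ) + v) * (q + 1 + 1 + (i + 1)) * N / ((i + 1) * N + (u + v)) ≤ X + Y := by
    intro h
    have := mul_le_mul_of_nonneg_right h hN0.le
    have e2 : ((X:ℝ) / N + Y / N) * N = X + Y := by field_simp
    rw [e2] at this
    refine le_of_eq_of_le ?_ this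
    field_simp
  apply goal'
  have a1 : ((i:ℝ) + 1) / (q + 1 + (i + 1)) ≤ ((u:ℝ) + v) / N := by
    rw [le_div_iff₀ hN0]; refine le_of_eq_of_le ?_ h1; field_simp
  have a2 : ((u:ℝ) + v) / N ≤ 1 := by rw [div_le_one hN0]; exact h2
  have a3 : (u:ℝ) / N ≤ ((u:ℝ) + v) / N := by gcongr; simp
  have a4 : ((u:ℝ) + v) / N ≤ X / N := by gcongr
  have a5 : (u:ℝ) / N * ((q + 1 : ℝ) + 1 + (i + 1)) / ((i + 1 : ℝ) + (u:ℝ) / N) ≤ X / N := by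
    rw [le_div_iff₀ hN0]; refine le_of_eq_of_le ?_ hXA1; field_simp
  have a6 : (((u:ℝ) + v) / N - u / N) * (q + 1) / ((i + 1 : ℝ) * (q + 1) / (q + 1 + (i + 1)) + (((u:ℝ) + v) / N - u / N)) ≤ Y / N := by
    have e : ((u:ℝ) + v) / N - u / N = v / N := by ring
    rw [e, le_div_iff₀ hN0]; refine le_of_eq_of_le ?_ hY1; field_simp
  rcases Nat.eq_zero_or_pos i with h0 | h0
  · subst h0
    simp only [Nat.cast_zero, zero_add] at *
    refine core1 (q + 1) _ (u / N) _ _ (by positivity) a1 a2 ?_ a3 a4 a5 a6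
    rcases Nat.eq_zero_or_pos u with hu | hu
    · left; simp [hu]
    · right
      have : N = q + 1 + 1 := by
        rw [lev_zero] at eL
        field_simp at eL
        linarith
      rw [this]
      have : (1:ℝ) ≤ u := by exact_mod_cast hu
      gcongr
  · have hXA2 := hXA i h0
    unfold phi at hXA2
    rw [eL] at hXA2
    push_cast at hXA2
    have h0r : (0:ℝ) < i := by exact_mod_cast h0
    refine core2 (q + 1) (i + 1) _ (u / N) _ _ (by positivity) (by linarith) a1 a2 a3 a4 a5 ?_ a6
    rw [le_div_iff₀ hN0]; refine le_of_eq_of_le ?_ hXA2; 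
    rw [add_sub_cancel_right]
    field_simp
    ring

lemma step (q u v X Y : ℕ) (hX : u + v ≤ X)
    (hXA : ∀ j, 1 ≤ j → phi (q + 1) j u ≤ X) (hY : ∀ j, 1 ≤ j → phi q j v ≤ Y) (j : ℕ) :
    phi (q + 1) j (u + v : ℕ) ≤ X + Y := by
  rcases Nat.eq_zero_or_pos (u + v) with h | h
  · rw [h]; simp [phi]; positivity
  · obtain ⟨i, h1, h2⟩ := exists_range q (u + v) h
    exact (phi_best (q + 1) i j _ (by exact_mod_cast h) h1 h2).trans
      (step_range q i u v X Y h h1 h2 hX hXA hY)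

open Classical in
/-- Number of points of `M` on level `k`. -/
noncomputable def cnt (n k : ℕ) (M : Set (Fin n → ℕ)) : ℕ :=
  ((Finset.Nat.antidiagonalTuple n k).filter (fun f => f ∈ M)).card

def IsUp {n : ℕ} (M : Set (Fin n → ℕ)) : Prop := ∀ x ∈ M, ∀ y, x ≤ y → y ∈ M

def secz {n : ℕ} (M : Set (Fin (n + 1) → ℕ)) : Set (Fin n → ℕ) := {x | (Fin.cons 0 x : Fin (n + 1) → ℕ) ∈ M}

def shf {n : ℕ} (M : Set (Fin (n + 1) → ℕ)) : Set (Fin (n + 1) → ℕ) :=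
  {x | (Fin.cons (x 0 + 1) (Fin.tail x) : Fin (n + 1) → ℕ) ∈ M}

lemma cnt_mono {n k : ℕ} {M M' : Set (Fin n → ℕ)} (h : M ⊆ M') : cnt n k M ≤ cnt n k M' := by
  classical
  unfold cnt
  refine Finset.card_le_card fun x hx => ?_
  simp only [Finset.mem_filter] at hx ⊢
  exact ⟨hx.1, h hx.2⟩

lemma secz_up {n : ℕ} {M : Set (Fin (n + 1) → ℕ)} (h : IsUp M) : IsUp (secz M) := by
  intro x hx y hxy
  refine h _ hx _ ?_
  intro i
  refine Fin.cases ?_ (fun i => ?_) i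
  · simp
  · simpa using hxy i

lemma shf_up {n : ℕ} {M : Set (Fin (n + 1) → ℕ)} (h : IsUp M) : IsUp (shf M) := by
  intro x hx y hxy
  refine h _ hx _ ?_
  intro i
  refine Fin.cases ?_ (fun i => ?_) i
  · simpa using hxy 0
  · simpa [Fin.tail] using hxy i.succ

lemma sub_shf {n : ℕ} {M : Set (Fin (n + 1) → ℕ)} (h : IsUp M) : M ⊆ shf M := by
  intro x hx
  refine h _ hx _ ?_
  intro i
  refine Fin.cases ?_ (fun i => ?_) i
  · simp
  · simp [Fin.tail]

lemma cnt_zero (n : ℕ) (M : Set (Fin (n + 1) → ℕ)) : cnt (n + 1) 0 M = cnt n 0 (secz M) := by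
  classical
  unfold cnt
  have e1 : ∀ m, Finset.Nat.antidiagonalTuple m 0 = {0} := fun m => Finset.Nat.antidiagonalTuple_zero_right m
  rw [e1, e1, Finset.filter_singleton, Finset.filter_singleton]
  have : (0 : Fin (n + 1) → ℕ) ∈ M ↔ (0 : Fin n → ℕ) ∈ secz M := by
    unfold secz
    have : (Fin.cons 0 (0 : Fin n → ℕ) : Fin (n + 1) → ℕ) = 0 := by
      funext i
      refine Fin.cases ?_ (fun i => ?_) i <;> simp
    simp [this]
  by_cases h : (0 : Fin (n + 1) → ℕ) ∈ M
  · rw [if_pos h, if_pos (this.1 h)]; rfl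
  · rw [if_neg h, if_neg (fun h' => h (this.2 h'))]; rfl

lemma cnt_succ (n k : ℕ) (M : Set (Fin (n + 1) → ℕ)) :
    cnt (n + 1) (k + 1) M = cnt (n + 1) k (shf M) + cnt n (k + 1) (secz M) := by
  classical
  unfold cnt
  rw [← Finset.card_filter_add_card_filter_not (fun f : Fin (n + 1) → ℕ => f 0 ≠ 0)]
  congr 1
  · symm
    refine Finset.card_bij (fun x _ => (Fin.cons (x 0 + 1) (Fin.tail x) : Fin (n + 1) → ℕ)) ?_ ?_ ?_
    · intro x hx
      simp only [Finset.mem_filter, Finset.Nat.mem_antidiagonalTuple] at hx ⊢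
      refine ⟨⟨?_, hx.2⟩, by simp⟩
      have := hx.1
      rw [Fin.sum_univ_succ] at this ⊢
      simp [Fin.tail]
      omega
    · intro x _ y _ hxy
      have := Fin.cons_inj.1 hxy
      rw [← Fin.cons_self_tail x, ← Fin.cons_self_tail y, this.2, show x 0 = y 0 by omega]
    · intro y hy
      simp only [Finset.mem_filter, Finset.Nat.mem_antidiagonalTuple] at hy
      have h0 : y 0 - 1 + 1 = y 0 := by have := hy.2; omega
      have e : (Fin.cons (y 0 - 1 + 1) (Fin.tail y) : Fin (n + 1) → ℕ) = y := by
        rw [h0, Fin.cons_self_tail]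
      refine ⟨Fin.cons (y 0 - 1) (Fin.tail y), ?_, ?_⟩
      · simp only [Finset.mem_filter, Finset.Nat.mem_antidiagonalTuple]
        constructor
        · have := hy.1.1
          rw [Fin.sum_univ_succ] at this ⊢
          simp [Fin.tail]
          omega
        · simp only [shf, Set.mem_ofPred_eq, Fin.cons_zero, Fin.tail_cons]
          rw [e]; exact hy.1.2
      · simp only [Fin.cons_zero, Fin.tail_cons]
        exact e
  · symm
    refine Finset.card_bij (fun x _ => (Fin.cons 0 x : Fin (n + 1) → ℕ)) ?_ ?_ ?_
    · intro x hx
      simp only [Finset.mem_filter, Finset.Nat.mem_antidiagonalTuple] at hx ⊢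
      refine ⟨⟨?_, hx.2⟩, by simp⟩
      rw [Fin.sum_univ_succ]
      simpa using hx.1
    · intro x _ y _ hxy
      exact (Fin.cons_inj.1 hxy).2
    · intro y hy
      simp only [Finset.mem_filter, Finset.Nat.mem_antidiagonalTuple, not_not] at hy
      have e : (Fin.cons 0 (Fin.tail y) : Fin (n + 1) → ℕ) = y := by
        rw [← hy.2, Fin.cons_self_tail]
      refine ⟨Fin.tail y, ?_, e⟩
      simp only [Finset.mem_filter, Finset.Nat.mem_antidiagonalTuple]
      constructor
      · have := hy.1.1
        rw [Fin.sum_univ_succ, hy.2] at this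
        simpa [Fin.tail] using this
      · simp only [secz, Set.mem_ofPred_eq, e]; exact hy.1.2

lemma cnt_none (k : ℕ) (M : Set (Fin 0 → ℕ)) : cnt 0 (k + 1) M = 0 := by
  simp [cnt]

lemma cnt_none_zero_le (M : Set (Fin 0 → ℕ)) : cnt 0 0 M ≤ 1 := by
  classical
  unfold cnt
  refine (Finset.card_filter_le _ _).trans ?_
  simp

lemma cnt_one_le (k : ℕ) : ∀ (M : Set (Fin 1 → ℕ)), cnt 1 k M ≤ 1 := by
  induction k with
  | zero => intro M; rw [cnt_zero]; exact cnt_none_zero_le _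
  | succ k ih => intro M; rw [cnt_succ, cnt_none]; exact ih _

lemma shadow (q : ℕ) : ∀ (k : ℕ) (M : Set (Fin (q + 1) → ℕ)), IsUp M → ∀ j, 1 ≤ j →
    phi q j (cnt (q + 1) k M) ≤ cnt (q + 1) (k + 1) M := by
  induction q with
  | zero =>
    intro k M hM j hj
    have h1 : cnt 1 k M ≤ cnt 1 (k + 1) M := by
      rw [cnt_succ, cnt_none]; exact cnt_mono (sub_shf hM)
    refine le_trans ?_ (show (cnt 1 k M : ℝ) ≤ cnt 1 (k + 1) M by exact_mod_cast h1)
    have h2 := cnt_one_le k M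
    have hl : lev 0 j = 1 := by simp [lev]
    unfold phi
    rw [hl]
    rcases Nat.le_one_iff_eq_zero_or_eq_one.1 h2 with h | h
    · simp [h]
    · have h' : cnt (0 + 1) k M = 1 := h
      rw [h']
      have : (0:ℝ) < j + 1 := by positivity
      simp
      rw [add_comm (1:ℝ)]
      rw [div_self this.ne']
  | succ q ihq =>
    intro k
    induction k with
    | zero =>
      intro M hM j hj
      have e := cnt_zero (q + 1) M
      have := step q 0 (cnt (q + 1) 0 (secz M)) (cnt (q + 2) 0 (shf M)) (cnt (q + 1) 1 (secz M))
        (by rw [zero_add, ← e]; exact cnt_mono (sub_shf hM))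
        (by intro j _; simp [phi])
        (by intro j hj; exact ihq 0 _ (secz_up hM) j hj) j
      rw [zero_add, ← e] at this
      rw [cnt_succ]
      push_cast
      exact this
    | succ k ihk =>
      intro M hM j hj
      have e := cnt_succ (q + 1) k M
      have := step q (cnt (q + 2) k (shf M)) (cnt (q + 1) (k + 1) (secz M))
        (cnt (q + 2) (k + 1) (shf M)) (cnt (q + 1) (k + 2) (secz M))
        (by rw [← e]; exact cnt_mono (sub_shf hM))
        (by intro j hj; exact ihk _ (shf_up hM) j hj)
        (by intro j hj; exact ihq (k + 1) _ (secz_up hM) j hj) j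
      rw [← e] at this
      rw [cnt_succ (q + 1) (k + 1)]
      push_cast
      exact this

lemma cnt_univ (q : ℕ) : ∀ k, cnt (q + 1) k Set.univ = (q + k).choose k := by
  induction q with
  | zero =>
    intro k
    induction k with
    | zero => simp [cnt]
    | succ k ih => rw [cnt_succ, cnt_none]; simpa [shf] using ih
  | succ q ihq =>
    intro k
    induction k with
    | zero => rw [cnt_zero]; simpa [secz] using ihq 0
    | succ k ih =>
      rw [cnt_succ]
      have h1 : shf (Set.univ : Set (Fin (q + 1 + 1) → ℕ)) = Set.univ := by simp [shf]
      have h2 : secz (Set.univ : Set (Fin (q + 1 + 1) → ℕ)) = Set.univ := by simp [secz]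
      rw [h1, h2, ih, ihq, show q + 1 + (k + 1) = (q + 1 + k) + 1 by ring, Nat.choose_succ_succ,
        show q + (k + 1) = q + 1 + k by ring]

lemma card_transport (B : Type*) [Fintype B] (n : ℕ) (e : B ≃ Fin n) (T : ℕ) (M : Set (B → ℕ))
    [DecidablePred fun f : B → ℕ => (∑ b, f b) = T ∧ f ∈ M] [DecidableEq B] :
    ((Fintype.piFinset fun _ : B => Finset.range (T + 1)).filter
        (fun f => (∑ b, f b) = T ∧ f ∈ M)).card = cnt n T {g | g ∘ e ∈ M} := by
  classical
  unfold cnt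
  refine Finset.card_bij (fun f _ => f ∘ e.symm) ?_ ?_ ?_
  · intro f hf
    simp only [Finset.mem_filter, Finset.Nat.mem_antidiagonalTuple] at hf ⊢
    refine ⟨?_, ?_⟩
    · rw [← hf.2.1]; exact Equiv.sum_comp e.symm f
    · simpa [Function.comp_assoc] using hf.2.2
  · intro f _ g _ h
    funext b
    simpa using congrFun h (e b)
  · intro g hg
    simp only [Finset.mem_filter, Finset.Nat.mem_antidiagonalTuple] at hg
    refine ⟨g ∘ e, ?_, ?_⟩
    · have hs : ∑ b, (g ∘ e) b = T := by rw [← hg.1]; exact Equiv.sum_comp e g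
      simp only [Finset.mem_filter, Fintype.mem_piFinset, Finset.mem_range]
      refine ⟨fun b => ?_, hs, hg.2⟩
      have := Finset.single_le_sum (f := g ∘ e) (fun i _ => Nat.zero_le _) (Finset.mem_univ b)
      omega
    · funext i; simp

lemma uniformProb_eq (B : Type*) [Fintype B] (q : ℕ) (e : B ≃ Fin (q + 1)) (T : ℕ) (M : Set (B → ℕ)) :
    uniformProb B T M = (cnt (q + 1) T {g | g ∘ e ∈ M} : ℝ) / lev q T := by
  classical
  unfold uniformProb lev
  have h1 := card_transport B (q + 1) e T M
  have h2 := card_transport B (q + 1) e T Set.univ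
  simp only [Set.mem_univ, and_true, Set.setOf_true] at h2
  rw [cnt_univ] at h2
  rw [← h1, ← h2]

theorem stmt_5 (B : Type*) [Fintype B] [Nonempty B] (M : Set (B → ℕ))
    (hM : ∀ x ∈ M, ∀ y : B → ℕ, x ≤ y → y ∈ M) (hMne : M.Nonempty)
    (T U : ℕ) (hT : uniformProb B T M ≥ 1 / 2)
    (hTmin : ∀ T' : ℕ, uniformProb B T' M ≥ 1 / 2 → T ≤ T')
    (hUT : U < T) :
    uniformProb B U M ≤ (U : ℝ) / ((T : ℝ) + (U : ℝ) - 1) := by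
  obtain ⟨q, hq⟩ : ∃ q, Fintype.card B = q + 1 :=
    ⟨Fintype.card B - 1, by have := Fintype.card_pos (α := B); omega⟩
  have e : B ≃ Fin (q + 1) := Fintype.equivFinOfCardEq hq
  obtain ⟨M', hM'⟩ : ∃ M' : Set (Fin (q + 1) → ℕ), M' = {g | g ∘ e ∈ M} := ⟨_, rfl⟩
  have hP : ∀ k, uniformProb B k M = (cnt (q + 1) k M' : ℝ) / lev q k := fun k => by
    rw [hM']; exact uniformProb_eq B q e k M
  have hup : IsUp M' := by
    intro x hx y hxy
    rw [hM'] at hx ⊢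
    exact hM _ hx _ (fun b => hxy (e b))
  have hnn : ∀ k, 0 ≤ uniformProb B k M := fun k => by
    rw [hP]; exact div_nonneg (by positivity) (lev_pos q k).le
  have hlocal : ∀ k : ℕ, 1 ≤ k → uniformProb B k M * (k + 1) / (k + uniformProb B k M) ≤
      uniformProb B (k + 1) M := by
    intro k hk
    have h := shadow q k M' hup k hk
    have hl := lev_pos q k
    have hl' := lev_pos q (k + 1)
    have hs := lev_succ q k
    have hkr : (1:ℝ) ≤ k := by exact_mod_cast hk
    rw [hP, hP, le_div_iff₀ hl']
    refine le_of_eq_of_le ?_ h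
    have e1 : lev q (k + 1) = lev q k * (q + k + 1) / (k + 1) := by
      rw [← hs]; field_simp
    rw [e1]
    unfold phi
    field_simp
    ring
  obtain ⟨S, rfl⟩ : ∃ S, T = S + 1 := ⟨T - 1, by omega⟩
  have hlt : ∀ k, k ≤ S → uniformProb B k M < 1 / 2 := by
    intro k hk
    by_contra hc
    have := hTmin k (not_lt.1 hc)
    omega
  rcases Nat.eq_zero_or_pos U with h0 | h0
  · subst h0
    have h := hlt 0 (by omega)
    rw [hP, lev_zero, div_one] at h
    rw [hP, lev_zero, div_one]
    have : cnt (q + 1) 0 M' = 0 := by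
      by_contra hc
      have : (1:ℝ) ≤ cnt (q + 1) 0 M' := by exact_mod_cast Nat.one_le_iff_ne_zero.2 hc
      linarith
    simp [this]
  · have main : ∀ d k : ℕ, 1 ≤ k → k + d = S → uniformProb B k M * (S + k) ≤ k := by
      intro d
      induction d with
      | zero =>
        intro k hk hkd
        have := hlt k (by omega)
        have e2 : (S:ℝ) = k := by exact_mod_cast (by omega : S = k)
        rw [e2]
        have hkr : (1:ℝ) ≤ k := by exact_mod_cast hk
        nlinarith
      | succ d ih =>
        intro k hk hkd
        have h1 := ih (k + 1) (by omega) (by omega)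
        have h2 := hlocal k hk
        have hkr : (1:ℝ) ≤ k := by exact_mod_cast hk
        have hp := hnn k
        have hS : (0:ℝ) ≤ S := by positivity
        push_cast at h1
        rw [div_le_iff₀ (by linarith)] at h2
        have h3 := mul_le_mul_of_nonneg_right h2 (show (0:ℝ) ≤ S + (k + 1) by linarith)
        have h4 := mul_le_mul_of_nonneg_right h1 (show (0:ℝ) ≤ k + uniformProb B k M by linarith)
        have h5 : (uniformProb B k M * (S + (k + 1))) * (k + 1 : ℝ) ≤
          (k + uniformProb B k M) * (k + 1 : ℝ) := by linarith
        have h6 := le_of_mul_le_mul_right h5 (by linarith)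
        linarith
    have h := main (S - U) U h0 (by omega)
    have hU : (1:ℝ) ≤ U := by exact_mod_cast h0
    have hS : (0:ℝ) ≤ S := by positivity
    push_cast
    rw [le_div_iff₀ (by linarith)]
    linarith
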